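/- Let G = (B ∪ W, E) be a finite bipartite graph admitting a BW-automorphism. Then the Bipartite Influence position G is a draw: Ls(G) = Rs(G) = 0 (so G is equivalent to the zero game). -/

import Mathlib

section Influence

variable {V : Type} [Fintype V] [DecidableEq V]

/-- The closed neighbourhood of `v` inside the position `A`. -/
def closedNbhd (G : SimpleGraph V) [DecidableRel G.Adj] (A : Finset V) (v : V) : Finset V :=
  insert v (A.filter fun u => G.Adj v u)

/-- The set of vertices removed when `v` is played in the position `A`:
`v` itself, its neighbours in `A`, and every vertex of the same colour as `v`
thereby left isolated. -/
def Rmv (G : SimpleGraph V) [DecidableRel G.Adj] (color : V → Bool)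
    (A : Finset V) (v : V) : Finset V :=
  closedNbhd G A v ∪
    A.filter (fun u => color u = color v ∧ ∀ w ∈ A, G.Adj u w → w ∈ closedNbhd G A v)

/-- The isolated vertices of the position `A`. -/
def isoSet (G : SimpleGraph V) [DecidableRel G.Adj] (A : Finset V) : Finset V :=
  A.filter fun u => ∀ w ∈ A, ¬ G.Adj u w

/-- Score of the Bipartite Influence position `A` with the player `turn` to
move (`true` = Left/black, maximizing; `false` = Right/white, minimizing).
Isolated vertices are immediately removed and credited to their owner
(`+1` per black, `−1` per white), the empty position scores `0`, and otherwise
the player to move picks a vertex of his/her colour `v`, scores `|Rmv(A,v)|`,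
and the opponent continues on `A \ Rmv(A,v)`. -/
noncomputable def scoreB (G : SimpleGraph V) [DecidableRel G.Adj] (color : V → Bool)
    (turn : Bool) (A : Finset V) : ℝ :=
  (((isoSet G A).filter fun u => color u = true).card : ℝ)
    - (((isoSet G A).filter fun u => color u = false).card : ℝ)
    + (if h : ((A \ isoSet G A).filter fun u => color u = turn).Nonempty then
        (if turn then
          ((A \ isoSet G A).filter fun u => color u = turn).attach.sup'
            (Finset.attach_nonempty_iff.mpr h) (fun x =>
              ((Rmv G color (A \ isoSet G A) x.1).card : ℝ) +
                scoreB G color false ((A \ isoSet G A) \ Rmv G color (A \ isoSet G A) x.1))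
        else
          ((A \ isoSet G A).filter fun u => color u = turn).attach.inf'
            (Finset.attach_nonempty_iff.mpr h) (fun x =>
              -((Rmv G color (A \ isoSet G A) x.1).card : ℝ) +
                scoreB G color true ((A \ isoSet G A) \ Rmv G color (A \ isoSet G A) x.1)))
      else 0)
termination_by A.card
decreasing_by
  all_goals {
    have hx : x.1 ∈ A \ isoSet G A := (Finset.mem_filter.mp x.2).1
    have hxA : x.1 ∈ A := (Finset.mem_sdiff.mp hx).1
    have hxr : x.1 ∈ Rmv G color (A \ isoSet G A) x.1 :=
      Finset.mem_union_left _ (Finset.mem_insert_self _ _)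
    have hsub : (A \ isoSet G A) \ Rmv G color (A \ isoSet G A) x.1 ⊆ A :=
      (Finset.sdiff_subset).trans (Finset.sdiff_subset)
    have hne : x.1 ∉ (A \ isoSet G A) \ Rmv G color (A \ isoSet G A) x.1 := by
      intro hmem
      exact (Finset.mem_sdiff.mp hmem).2 hxr
    exact Finset.card_lt_card ⟨hsub, fun hAsub => hne (hAsub hxA)⟩
  }

end Influence

theorem Bool.eq_of_ne_of_ne {a b c : Bool} (hb : a ≠ b) (hc : a ≠ c) : b = c := by
  cases a <;> cases b <;> simp_all

section InfluenceStrategy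

/-- The vertices removed by two successive moves `u`, `v` of the same colour. -/
def jointRmv {V : Type} (G : SimpleGraph V) [DecidableRel G.Adj] (color : V → Bool)
    (A : Finset V) (u v : V) : Finset V :=
  A.filter fun x => (color x ≠ color u ∧ (G.Adj u x ∨ G.Adj v x)) ∨
    (color x = color u ∧ ∀ w ∈ A, G.Adj x w → G.Adj u w ∨ G.Adj v w)

theorem jointRmv_comm {V : Type} {G : SimpleGraph V} [DecidableRel G.Adj] {color : V → Bool}
    {A : Finset V} {u v : V} (hc : color u = color v) :
    jointRmv G color A u v = jointRmv G color A v u := by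
  ext x
  simp only [jointRmv, Finset.mem_filter, hc, or_comm]

variable {V : Type} [Fintype V] [DecidableEq V] {G : SimpleGraph V} [DecidableRel G.Adj] {color : V → Bool}

theorem mem_isoSet {A : Finset V} {x : V} :
    x ∈ isoSet G A ↔ x ∈ A ∧ ∀ w ∈ A, ¬ G.Adj x w := by
  simp [isoSet]

theorem mem_Rmv (hbip : ∀ u v : V, G.Adj u v → color u ≠ color v) {A : Finset V} {v x : V}
    (hv : v ∈ A) :
    x ∈ Rmv G color A v ↔ x ∈ A ∧ ((color x ≠ color v ∧ G.Adj v x) ∨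
      (color x = color v ∧ ∀ w ∈ A, G.Adj x w → G.Adj v w)) := by
  simp only [Rmv, closedNbhd, Finset.mem_union, Finset.mem_insert, Finset.mem_filter]
  constructor
  · rintro ((rfl | ⟨hx, h⟩) | ⟨hx, hc, h⟩)
    · exact ⟨hv, .inr ⟨rfl, fun _ _ h => h⟩⟩
    · exact ⟨hx, .inl ⟨(hbip _ _ h).symm, h⟩⟩
    · refine ⟨hx, .inr ⟨hc, fun w hw hxw => ?_⟩⟩
      rcases h w hw hxw with rfl | h
      · exact absurd hc (hbip _ _ hxw)
      · exact h.2
  · rintro ⟨hx, ⟨-, h⟩ | ⟨hc, h⟩⟩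
    · exact .inl (.inr ⟨hx, h⟩)
    · exact .inr ⟨hx, hc, fun w hw hxw => .inr ⟨hw, h w hw hxw⟩⟩

theorem Rmv_subset (hbip : ∀ u v : V, G.Adj u v → color u ≠ color v) {A : Finset V} {v : V}
    (hv : v ∈ A) : Rmv G color A v ⊆ A :=
  fun _ hx => ((mem_Rmv hbip hv).1 hx).1

theorem self_mem_Rmv {A : Finset V} {v : V} : v ∈ Rmv G color A v :=
  Finset.mem_union_left _ (Finset.mem_insert_self _ _)

theorem card_sdiff_Rmv_lt {A : Finset V} {v : V} (hv : v ∈ A) :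
    (A \ Rmv G color A v).card < A.card :=
  Finset.card_lt_card ⟨Finset.sdiff_subset, fun h => (Finset.mem_sdiff.1 (h hv)).2 self_mem_Rmv⟩

theorem isoSet_sdiff_isoSet (A : Finset V) : isoSet G (A \ isoSet G A) = ∅ := by
  ext x
  simp only [mem_isoSet, Finset.mem_sdiff, Finset.notMem_empty, iff_false]
  rintro ⟨⟨hx, hn⟩, h⟩
  push Not at hn
  obtain ⟨w, hw, hxw⟩ := hn hx
  exact h w ⟨hw, fun h' => h'.2 x hx hxw.symm⟩ hxw

theorem isoSet_sdiff_Rmv (hbip : ∀ u v : V, G.Adj u v → color u ≠ color v) {A : Finset V}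
    (hA : isoSet G A = ∅) {v : V} (hv : v ∈ A) :
    isoSet G (A \ Rmv G color A v) = ∅ := by
  ext x
  simp only [mem_isoSet, Finset.mem_sdiff, Finset.notMem_empty, iff_false]
  rintro ⟨⟨hx, hxR⟩, h⟩
  have hxA : x ∉ isoSet G A := by simp [hA]
  simp only [mem_isoSet, mem_Rmv hbip hv] at hxA hxR h
  by_cases hc : color x = color v
  · have : ∃ w ∈ A, G.Adj x w ∧ ¬ G.Adj v w := by
      by_contra! hcon
      exact hxR ⟨hx, .inr ⟨hc, hcon⟩⟩
    obtain ⟨w, hw, hxw, hvw⟩ := this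
    have := hbip _ _ hxw
    exact h w ⟨hw, by grind⟩ hxw
  · have : ∃ w ∈ A, G.Adj x w := by
      by_contra! hcon
      exact hxA ⟨hx, hcon⟩
    obtain ⟨w, hw, hxw⟩ := this
    have := hbip _ _ hxw
    refine h w ⟨hw, ?_⟩ hxw
    rintro ⟨-, ⟨hwc, -⟩ | ⟨-, hwv⟩⟩
    · exact hwc (Bool.eq_of_ne_of_ne this hc)
    · exact hxR ⟨hx, .inl ⟨hc, hwv x hx hxw.symm⟩⟩

/-- Moves of opposite colours at non-adjacent vertices do not interfere. -/
theorem Rmv_sdiff_Rmv (hbip : ∀ u v : V, G.Adj u v → color u ≠ color v) {A : Finset V} {v w : V}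
    (hv : v ∈ A) (hw : w ∈ A) (hc : color w ≠ color v) (hvw : ¬ G.Adj v w) :
    Rmv G color (A \ Rmv G color A v) w = Rmv G color A w := by
  have hw' : w ∈ A \ Rmv G color A v := by
    simp only [Finset.mem_sdiff, mem_Rmv hbip hv]
    grind
  have hsymm : ∀ a b, G.Adj a b → G.Adj b a := fun _ _ h => h.symm
  ext x
  simp only [mem_Rmv hbip hw', mem_Rmv hbip hw, Finset.mem_sdiff, mem_Rmv hbip hv]
  constructor
  · rintro ⟨⟨hx, hxR⟩, h | ⟨hxc, h⟩⟩
    · exact ⟨hx, .inl h⟩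
    · refine ⟨hx, .inr ⟨hxc, fun z hz hxz => h z ⟨hz, ?_⟩ hxz⟩⟩
      have := Bool.eq_of_ne_of_ne (hbip _ _ hxz) (hxc.trans_ne hc)
      grind
  · rintro ⟨hx, ⟨hxc, h⟩ | ⟨hxc, h⟩⟩
    · have := Bool.eq_of_ne_of_ne hxc.symm hc
      refine ⟨⟨hx, ?_⟩, .inl ⟨hxc, h⟩⟩
      grind
    · refine ⟨⟨hx, ?_⟩, .inr ⟨hxc, fun z hz hxz => h z hz.1 hxz⟩⟩
      grind

theorem disjoint_Rmv (hbip : ∀ u v : V, G.Adj u v → color u ≠ color v) {A : Finset V} {v w : V}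
    (hv : v ∈ A) (hw : w ∈ A) (hc : color w ≠ color v) (hvw : ¬ G.Adj v w) :
    Disjoint (Rmv G color A v) (Rmv G color A w) := by
  have hsymm : ∀ a b, G.Adj a b → G.Adj b a := fun _ _ h => h.symm
  rw [Finset.disjoint_left]
  intro x
  simp only [mem_Rmv hbip hw, mem_Rmv hbip hv]
  have := fun h : color w ≠ color x => Bool.eq_of_ne_of_ne h hc
  grind

theorem Rmv_eq_jointRmv (hbip : ∀ u v : V, G.Adj u v → color u ≠ color v) {A : Finset V} {u v : V}
    (hu : u ∈ A) (hc : color u = color v) (hv : v ∈ Rmv G color A u) :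
    Rmv G color A u = jointRmv G color A u v := by
  rw [mem_Rmv hbip hu] at hv
  ext x
  simp only [mem_Rmv hbip hu, jointRmv, Finset.mem_filter]
  grind

theorem Rmv_union_Rmv (hbip : ∀ u v : V, G.Adj u v → color u ≠ color v) {A : Finset V} {u v : V}
    (hu : u ∈ A) (hv : v ∈ A) (hc : color u = color v) (hvu : v ∉ Rmv G color A u) :
    Rmv G color A u ∪ Rmv G color (A \ Rmv G color A u) v = jointRmv G color A u v := by
  have hv' : v ∈ A \ Rmv G color A u := Finset.mem_sdiff.2 ⟨hv, hvu⟩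
  ext x
  simp only [mem_Rmv hbip hu, mem_Rmv hbip hv', jointRmv, Finset.mem_filter, Finset.mem_union,
    Finset.mem_sdiff]
  constructor
  · rintro (⟨hx, h | ⟨hxc, h⟩⟩ | ⟨⟨hx, hn⟩, h | ⟨hxc, h⟩⟩)
    · grind
    · exact ⟨hx, .inr ⟨hxc, fun w hw hxw => .inl (h w hw hxw)⟩⟩
    · grind
    · refine ⟨hx, .inr ⟨hxc.trans hc.symm, fun w hw hxw => ?_⟩⟩
      have := hbip _ _ hxw
      grind
  · rintro ⟨hx, h | ⟨hxc, h⟩⟩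
    · grind
    · by_cases hd : ∀ w ∈ A, G.Adj x w → G.Adj u w
      · exact .inl ⟨hx, .inr ⟨hxc, hd⟩⟩
      · refine .inr ⟨⟨hx, by grind⟩, .inr ⟨hxc.trans hc, fun w hw hxw => ?_⟩⟩
        have := hbip _ _ hxw
        grind

/-- The value of the best move in a position without isolated vertices. -/
noncomputable def moveScore (G : SimpleGraph V) [DecidableRel G.Adj] (color : V → Bool)
    (turn : Bool) (A : Finset V) : ℝ :=
  if h : (A.filter fun u => color u = turn).Nonempty then
    (if turn then
      (A.filter fun u => color u = turn).attach.sup' (Finset.attach_nonempty_iff.mpr h)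
        (fun x => ((Rmv G color A x.1).card : ℝ) + scoreB G color false (A \ Rmv G color A x.1))
    else
      (A.filter fun u => color u = turn).attach.inf' (Finset.attach_nonempty_iff.mpr h)
        (fun x => -((Rmv G color A x.1).card : ℝ) + scoreB G color true (A \ Rmv G color A x.1)))
  else 0

theorem scoreB_eq_moveScore (turn : Bool) (A : Finset V) :
    scoreB G color turn A =
      (((isoSet G A).filter fun u => color u = true).card : ℝ)
        - (((isoSet G A).filter fun u => color u = false).card : ℝ)
        + moveScore G color turn (A \ isoSet G A) := by
  rw [scoreB]
  rfl

theorem scoreB_of_isoSet_eq_empty {A : Finset V} (hA : isoSet G A = ∅) (turn : Bool) :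
    scoreB G color turn A = moveScore G color turn A := by
  rw [scoreB_eq_moveScore, hA]
  simp

theorem scoreB_eq_add_scoreB (turn : Bool) (A : Finset V) :
    scoreB G color turn A =
      (((isoSet G A).filter fun u => color u = true).card : ℝ)
        - (((isoSet G A).filter fun u => color u = false).card : ℝ)
        + scoreB G color turn (A \ isoSet G A) := by
  rw [scoreB_of_isoSet_eq_empty (isoSet_sdiff_isoSet A), scoreB_eq_moveScore]

/-- The sign with which the player `turn` counts the score. -/
def playerSign (turn : Bool) : ℝ := if turn then 1 else -1

theorem card_add_le_scoreB {A : Finset V} (hA : isoSet G A = ∅) {v : V} (hv : v ∈ A) :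
    ((Rmv G color A v).card : ℝ)
        + playerSign (color v) * scoreB G color (!color v) (A \ Rmv G color A v) ≤
      playerSign (color v) * scoreB G color (color v) A := by
  rw [scoreB_of_isoSet_eq_empty hA, moveScore]
  have hmem : v ∈ A.filter fun u => color u = color v := by simp [hv]
  rw [dif_pos ⟨v, hmem⟩]
  generalize color v = t at hmem ⊢
  cases t
  · have := Finset.inf'_le (fun x : {x // x ∈ A.filter fun u => color u = false} =>
      -((Rmv G color A x.1).card : ℝ) + scoreB G color true (A \ Rmv G color A x.1))
      (Finset.mem_attach _ ⟨v, hmem⟩)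
    simp only [playerSign, Bool.not_false, Bool.false_eq_true, if_false]
    linarith
  · have := Finset.le_sup' (fun x : {x // x ∈ A.filter fun u => color u = true} =>
      ((Rmv G color A x.1).card : ℝ) + scoreB G color false (A \ Rmv G color A x.1))
      (Finset.mem_attach _ ⟨v, hmem⟩)
    simp only [playerSign, Bool.not_true, if_true]
    linarith

theorem exists_scoreB_eq_card_add {A : Finset V} (hA : isoSet G A = ∅) {t : Bool}
    (h : ∃ v ∈ A, color v = t) :
    ∃ v ∈ A, color v = t ∧ playerSign t * scoreB G color t A =
      ((Rmv G color A v).card : ℝ)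
        + playerSign t * scoreB G color (!t) (A \ Rmv G color A v) := by
  obtain ⟨v₀, hv₀, hc₀⟩ := h
  have hne : (A.filter fun u => color u = t).Nonempty := ⟨v₀, by simp [hv₀, hc₀]⟩
  rw [scoreB_of_isoSet_eq_empty hA, moveScore, dif_pos hne]
  cases t
  · obtain ⟨⟨v, hv⟩, -, h⟩ := Finset.exists_mem_eq_inf' (Finset.attach_nonempty_iff.mpr hne)
      (fun x : {x // x ∈ A.filter fun u => color u = false} =>
        -((Rmv G color A x.1).card : ℝ) + scoreB G color true (A \ Rmv G color A x.1))
    refine ⟨v, (Finset.mem_filter.1 hv).1, (Finset.mem_filter.1 hv).2, ?_⟩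
    simp only [playerSign, Bool.not_false, Bool.false_eq_true, if_false, h]
    ring
  · obtain ⟨⟨v, hv⟩, -, h⟩ := Finset.exists_mem_eq_sup' (Finset.attach_nonempty_iff.mpr hne)
      (fun x : {x // x ∈ A.filter fun u => color u = true} =>
        ((Rmv G color A x.1).card : ℝ) + scoreB G color false (A \ Rmv G color A x.1))
    refine ⟨v, (Finset.mem_filter.1 hv).1, (Finset.mem_filter.1 hv).2, ?_⟩
    simp only [playerSign, Bool.not_true, if_true, h]
    ring

theorem exists_color_eq (hbip : ∀ u v : V, G.Adj u v → color u ≠ color v) {A : Finset V}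
    (hA : isoSet G A = ∅) (hne : A.Nonempty) (t : Bool) : ∃ v ∈ A, color v = t := by
  obtain ⟨x, hx⟩ := hne
  have hxA : x ∉ isoSet G A := by simp [hA]
  simp only [mem_isoSet, not_and, not_forall, not_not] at hxA
  obtain ⟨w, hw, hxw⟩ := hxA hx
  have := hbip _ _ hxw
  by_cases h : color x = t
  · exact ⟨x, hx, h⟩
  · exact ⟨w, hw, Bool.eq_of_ne_of_ne this h⟩

theorem scoreB_empty (t : Bool) : scoreB G color t ∅ = 0 := by
  rw [scoreB_of_isoSet_eq_empty (by simp [isoSet]), moveScore]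
  simp

theorem scoreB_le_card (hbip : ∀ u v : V, G.Adj u v → color u ≠ color v) (t : Bool)
    (A : Finset V) (hA : isoSet G A = ∅) : scoreB G color t A ≤ A.card := by
  induction hn : A.card using Nat.strong_induction_on generalizing A t with
  | _ n ih =>
    subst hn
    rcases A.eq_empty_or_nonempty with rfl | hne
    · simp [scoreB_empty]
    · obtain ⟨v, hv, -, h⟩ := exists_scoreB_eq_card_add hA (exists_color_eq hbip hA hne t)
      have h1 := ih _ (card_sdiff_Rmv_lt hv) (!t) _ (isoSet_sdiff_Rmv hbip hA hv) rfl
      have h2 := Finset.card_sdiff_add_card_eq_card (Rmv_subset hbip hv)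
      have h3 : ((A \ Rmv G color A v).card : ℝ) + ((Rmv G color A v).card : ℝ) = A.card := by
        exact_mod_cast h2
      have h4 : (0 : ℝ) ≤ (Rmv G color A v).card := Nat.cast_nonneg _
      cases t <;> simp [playerSign] at h h1 <;> linarith

/-- A free move of Left never lowers the score. -/
theorem scoreB_le_card_Rmv_add (hbip : ∀ u v : V, G.Adj u v → color u ≠ color v)
    (A : Finset V) (hA : isoSet G A = ∅) (v : V) (hv : v ∈ A) (hcv : color v = true) (t : Bool) :
    scoreB G color t A ≤ (Rmv G color A v).card + scoreB G color t (A \ Rmv G color A v) := by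
  induction hn : A.card using Nat.strong_induction_on generalizing A v t with
  | _ n ih =>
  subst hn
  have hA' := isoSet_sdiff_Rmv hbip hA hv
  have hlt := card_sdiff_Rmv_lt (G := G) (color := color) hv
  cases t
  · rcases (A \ Rmv G color A v).eq_empty_or_nonempty with he | hne
    · rw [he, scoreB_empty, add_zero]
      refine (scoreB_le_card hbip _ A hA).trans ?_
      exact_mod_cast Finset.card_le_card (Finset.sdiff_eq_empty_iff_subset.1 he)
    · obtain ⟨w, hw, hcw, h⟩ := exists_scoreB_eq_card_add hA' (exists_color_eq hbip hA' hne false)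
      obtain ⟨hwA, hwR⟩ := Finset.mem_sdiff.1 hw
      have hc : color w ≠ color v := by simp [hcv, hcw]
      have hvw : ¬ G.Adj v w := fun h => hwR ((mem_Rmv hbip hv).2 ⟨hwA, .inl ⟨hc, h⟩⟩)
      rw [Rmv_sdiff_Rmv hbip hv hwA hc hvw] at h
      have hle := card_add_le_scoreB (color := color) hA hwA
      have hv' : v ∈ A \ Rmv G color A w := Finset.mem_sdiff.2 ⟨hv,
        Finset.disjoint_left.1 (disjoint_Rmv hbip hv hwA hc hvw) self_mem_Rmv⟩
      have hfree := ih _ (card_sdiff_Rmv_lt hwA) _ (isoSet_sdiff_Rmv hbip hA hwA) v hv' hcv true rfl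
      rw [Rmv_sdiff_Rmv hbip hwA hv hc.symm (fun h => hvw h.symm), sdiff_right_comm] at hfree
      simp only [hcw, playerSign, Bool.not_false, Bool.false_eq_true, if_false] at h hle
      linarith
  · have hjoint : ∀ a ∈ A, ∀ b ∈ A, color a = true → color b = true →
        (Rmv G color A a).card + scoreB G color false (A \ Rmv G color A a) ≤
          (jointRmv G color A a b).card + scoreB G color false (A \ jointRmv G color A a b) := by
      intro a ha b hb hca hcb
      by_cases hba : b ∈ Rmv G color A a
      · rw [← Rmv_eq_jointRmv hbip ha (hca.trans hcb.symm) hba]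
      · have hfree := ih _ (card_sdiff_Rmv_lt ha) _ (isoSet_sdiff_Rmv hbip hA ha) b
          (Finset.mem_sdiff.2 ⟨hb, hba⟩) hcb false rfl
        rw [← Rmv_union_Rmv hbip ha hb (hca.trans hcb.symm) hba, ← Finset.sup_eq_union, ← sdiff_sdiff_left, Finset.sup_eq_union,
          Finset.card_union_of_disjoint]
        · push_cast
          linarith
        · exact Finset.disjoint_sdiff.mono_right
            (Rmv_subset hbip (Finset.mem_sdiff.2 ⟨hb, hba⟩))
    obtain ⟨u, hu, hcu, h⟩ := exists_scoreB_eq_card_add hA ⟨v, hv, hcv⟩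
    have hJ := hjoint u hu v hv hcu hcv
    have hc := hcv.trans hcu.symm
    rw [jointRmv_comm hc.symm] at hJ
    simp only [playerSign, Bool.not_true, if_true, one_mul] at h
    refine (h.trans_le hJ).trans ?_
    by_cases huv : u ∈ Rmv G color A v
    · rw [← Rmv_eq_jointRmv hbip hv hc huv]
      gcongr
      rcases (A \ Rmv G color A v).eq_empty_or_nonempty with he | hne
      · simp [he, scoreB_empty]
      · obtain ⟨b, hb, hcb⟩ := exists_color_eq hbip hA' hne true
        have hfree := ih _ hlt _ hA' b hb hcb false rfl
        have hle := card_add_le_scoreB (color := color) hA' hb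
        simp only [hcb, playerSign, Bool.not_true, if_true] at hle
        linarith
    · have hu' := Finset.mem_sdiff.2 ⟨hu, huv⟩
      have hle := card_add_le_scoreB (color := color) hA' hu'
      simp only [hcu, playerSign, Bool.not_true, if_true] at hle
      rw [← Rmv_union_Rmv hbip hv hu hc huv, ← Finset.sup_eq_union, ← sdiff_sdiff_left, Finset.sup_eq_union, Finset.card_union_of_disjoint]
      · push_cast
        linarith
      · exact Finset.disjoint_sdiff.mono_right (Rmv_subset hbip hu')

/-- Influence has no zugzwang. -/
theorem scoreB_false_le_scoreB_true (hbip : ∀ u v : V, G.Adj u v → color u ≠ color v)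
    (A : Finset V) (hA : isoSet G A = ∅) : scoreB G color false A ≤ scoreB G color true A := by
  rcases A.eq_empty_or_nonempty with rfl | hne
  · simp [scoreB_empty]
  · obtain ⟨v, hv, hcv⟩ := exists_color_eq hbip hA hne true
    have hfree := scoreB_le_card_Rmv_add hbip A hA v hv hcv false
    have hle := card_add_le_scoreB (color := color) hA hv
    simp only [hcv, playerSign, Bool.not_true, if_true] at hle
    linarith

theorem map_mem_Rmv_iff (hbip : ∀ u v : V, G.Adj u v → color u ≠ color v) {φ : V → V}
    (hauto : ∀ u v : V, G.Adj u v ↔ G.Adj (φ u) (φ v)) (hinv : ∀ v : V, φ (φ v) = v)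
    (hcol : ∀ v : V, color (φ v) = ! color v) {A : Finset V} (hφ : ∀ v, φ v ∈ A ↔ v ∈ A)
    {v x : V} (hv : v ∈ A) : φ x ∈ Rmv G color A (φ v) ↔ x ∈ Rmv G color A v := by
  have hforall : (∀ w ∈ A, G.Adj (φ x) w → G.Adj (φ v) w) ↔
      ∀ w ∈ A, G.Adj x w → G.Adj v w := by
    constructor
    · intro h w hw hxw
      exact (hauto _ _).2 (h _ ((hφ w).2 hw) ((hauto _ _).1 hxw))
    · intro h w hw hxw
      rw [hauto, hinv] at hxw ⊢
      exact h _ ((hφ w).2 hw) hxw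
  rw [mem_Rmv hbip ((hφ v).2 hv), mem_Rmv hbip hv, hφ, ← hauto, hforall]
  simp [hcol]

/-- Answering every move by its image under the automorphism, the second player does not lose. -/
theorem playerSign_mul_scoreB_nonpos (hbip : ∀ u v : V, G.Adj u v → color u ≠ color v) {φ : V → V}
    (hauto : ∀ u v : V, G.Adj u v ↔ G.Adj (φ u) (φ v)) (hinv : ∀ v : V, φ (φ v) = v)
    (hcol : ∀ v : V, color (φ v) = ! color v) (hnadj : ∀ v, ¬ G.Adj v (φ v)) (t : Bool)
    (A : Finset V) (hA : isoSet G A = ∅) (hφ : ∀ v, φ v ∈ A ↔ v ∈ A) :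
    playerSign t * scoreB G color t A ≤ 0 := by
  induction hn : A.card using Nat.strong_induction_on generalizing A with
  | _ n ih =>
  subst hn
  rcases A.eq_empty_or_nonempty with rfl | hne
  · simp [scoreB_empty]
  obtain ⟨v, hv, hcv, h⟩ := exists_scoreB_eq_card_add hA (exists_color_eq hbip hA hne t)
  have hw := (hφ v).2 hv
  have hc : color (φ v) ≠ color v := by simp [hcol]
  have hdisj := disjoint_Rmv hbip hv hw hc (hnadj v)
  have hw' : φ v ∈ A \ Rmv G color A v :=
    Finset.mem_sdiff.2 ⟨hw, Finset.disjoint_right.1 hdisj self_mem_Rmv⟩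
  have hA' := isoSet_sdiff_Rmv hbip hA hv
  have hle := card_add_le_scoreB (color := color) hA' hw'
  have hrmv := Rmv_sdiff_Rmv hbip hv hw hc (hnadj v)
  have hA'' := isoSet_sdiff_Rmv hbip hA' hw'
  have hlt := (card_sdiff_Rmv_lt (G := G) (color := color) hw').trans (card_sdiff_Rmv_lt hv)
  rw [hrmv] at hle hA'' hlt
  have hmap : ∀ x, φ x ∈ Rmv G color A (φ v) ↔ x ∈ Rmv G color A v := fun x =>
    map_mem_Rmv_iff hbip hauto hinv hcol hφ hv
  have hmap' : ∀ x, φ x ∈ Rmv G color A v ↔ x ∈ Rmv G color A (φ v) := fun x => by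
    rw [← hmap, hinv]
  have hcard : (Rmv G color A v).card = (Rmv G color A (φ v)).card :=
    Finset.card_nbij' φ φ (fun x hx => (hmap x).2 hx) (fun x hx => (hmap' x).2 hx)
      (fun x _ => hinv x) (fun x _ => hinv x)
  have hih := ih _ hlt _ hA'' (fun x => by simp only [Finset.mem_sdiff, hφ, hmap, hmap']; tauto) rfl
  rw [hcard] at h
  cases t <;> simp [hcol, hcv, playerSign] at h hle hih ⊢ <;> linarith

end InfluenceStrategy

/-- A bipartite graph admitting a BW-automorphism (an involutive automorphism
exchanging the colours and moving every vertex to distance at least `3`) is a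
draw for Bipartite Influence. -/
theorem influence_bw_automorphism_draw {V : Type} [Fintype V] [DecidableEq V]
    (G : SimpleGraph V) [DecidableRel G.Adj] (color : V → Bool)
    (hbip : ∀ u v : V, G.Adj u v → color u ≠ color v)
    (φ : V → V)
    (hauto : ∀ u v : V, G.Adj u v ↔ G.Adj (φ u) (φ v))
    (hinv : ∀ v : V, φ (φ v) = v)
    (hcol : ∀ v : V, color (φ v) = ! color v)
    (hdist : ∀ v : V, G.Reachable v (φ v) → 3 ≤ G.dist v (φ v)) :
    scoreB G color true Finset.univ = 0 ∧ scoreB G color false Finset.univ = 0 := by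
  have hnadj : ∀ v, ¬ G.Adj v (φ v) := fun v h => by
    have h3 := hdist v h.reachable
    rw [SimpleGraph.dist_eq_one_iff_adj.2 h] at h3
    omega
  have hiso : ∀ v, φ v ∈ isoSet G Finset.univ ↔ v ∈ isoSet G Finset.univ := fun v => by
    simp only [mem_isoSet, Finset.mem_univ, true_and, true_imp_iff]
    refine ⟨fun h w hw => h (φ w) ((hauto _ _).1 hw), fun h w hw => h (φ w) ?_⟩
    rwa [hauto, hinv]
  have hcard : ((isoSet G Finset.univ).filter fun u => color u = true).card =
      ((isoSet G Finset.univ).filter fun u => color u = false).card := by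
    refine Finset.card_nbij' φ φ ?_ ?_ (fun x _ => hinv x) (fun x _ => hinv x) <;>
    · intro x hx
      have hx' := Finset.mem_filter.1 hx
      exact Finset.mem_filter.2 ⟨(hiso x).2 hx'.1, by simp [hcol, hx'.2]⟩
  have hA := isoSet_sdiff_isoSet (G := G) Finset.univ
  have hle := playerSign_mul_scoreB_nonpos hbip hauto hinv hcol hnadj
  have hL := hle true _ hA (by simp [hiso])
  have hR := hle false _ hA (by simp [hiso])
  have hLR := scoreB_false_le_scoreB_true hbip _ hA
  simp only [playerSign, Bool.false_eq_true, if_false, if_true] at hL hR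
  rw [scoreB_eq_add_scoreB true, scoreB_eq_add_scoreB false, hcard]
  constructor <;> linarith
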